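/- If ψ : ℝ → ℂ is locally absolutely continuous with ψ' ∈ L²(ℝ) and x ↦ ψ(x)(1 - |ψ(x)|²) ∈ L²(ℝ), then ψ is bounded on ℝ; that is, the energy space is contained in L^∞(ℝ). -/

import Mathlib

open Real MeasureTheory

theorem energy_space_subset_Linfty (ψ : ℝ → ℂ)
    (hdiff : Differentiable ℝ ψ)
    (hderiv : Integrable (fun x => ‖deriv ψ x‖ ^ 2))
    (hpot : Integrable (fun x => ‖ψ x * (1 - (‖ψ x‖ ^ 2 : ℝ))‖ ^ 2)) :
    ∃ M : ℝ, ∀ x : ℝ, ‖ψ x‖ ≤ M := by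
  set C : ℝ := ∫ x, ‖deriv ψ x‖ ^ 2 with hC
  set D : ℝ := ∫ x, ‖ψ x * (1 - (‖ψ x‖ ^ 2 : ℝ))‖ ^ 2 with hD
  have hD0 : 0 ≤ D := integral_nonneg fun x => by positivity
  -- local oscillation bound
  have osc : ∀ x y : ℝ, x ≤ y → y ≤ x + 1 → ‖ψ y - ψ x‖ ≤ 1 + C := by
    intro x y hxy hy
    have hg : IntervalIntegrable (fun t => 1 + ‖deriv ψ t‖ ^ 2) volume x y :=
      intervalIntegrable_const.add hderiv.intervalIntegrable
    have hi : IntervalIntegrable (deriv ψ) volume x y := by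
      refine hg.mono_fun (measurable_deriv ψ).aestronglyMeasurable ?_
      refine Filter.Eventually.of_forall fun t => ?_
      have : 0 ≤ 1 + ‖deriv ψ t‖ ^ 2 := by positivity
      simp only [Real.norm_eq_abs, abs_of_nonneg this]
      nlinarith [sq_nonneg (‖deriv ψ t‖ - 1)]
    rw [← intervalIntegral.integral_eq_sub_of_hasDerivAt
      (fun t _ => (hdiff t).hasDerivAt) hi]
    calc ‖∫ t in x..y, deriv ψ t‖ ≤ ∫ t in x..y, (1 + ‖deriv ψ t‖ ^ 2) := by
          refine intervalIntegral.norm_integral_le_of_norm_le hxy ?_ hg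
          refine Filter.Eventually.of_forall fun t _ => ?_
          nlinarith [sq_nonneg (‖deriv ψ t‖ - 1)]
      _ = (y - x) + ∫ t in x..y, ‖deriv ψ t‖ ^ 2 := by
          rw [intervalIntegral.integral_add intervalIntegrable_const hderiv.intervalIntegrable]
          simp
      _ ≤ 1 + C := by
          rw [intervalIntegral.integral_of_le hxy]
          have := setIntegral_le_integral (s := Set.Ioc x y) hderiv
            (Filter.Eventually.of_forall fun t => by positivity)
          linarith
  refine ⟨1 + C + (2 + D), fun x => ?_⟩
  by_contra! hx
  have low : ∀ t ∈ Set.Icc x (x + 1), D + 1 ≤ ‖ψ t * (1 - (‖ψ t‖ ^ 2 : ℝ))‖ ^ 2 := by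
    intro t ht
    have h1 := osc x t ht.1 ht.2
    have h2 : ‖ψ x‖ - ‖ψ t‖ ≤ ‖ψ t - ψ x‖ := by
      rw [norm_sub_rev]; exact norm_sub_norm_le _ _
    have h3 : 2 + D ≤ ‖ψ t‖ := by linarith
    have h4 : ‖(1 - ((‖ψ t‖ ^ 2 : ℝ) : ℂ))‖ = |1 - ‖ψ t‖ ^ 2| := by
      rw [← Complex.ofReal_one, ← Complex.ofReal_sub, Complex.norm_real, Real.norm_eq_abs]
    have h5 : 1 ≤ |1 - ‖ψ t‖ ^ 2| := by
      rw [abs_sub_comm]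
      exact le_trans (by nlinarith) (le_abs_self _)
    rw [norm_mul, h4]
    have h6 : 2 + D ≤ ‖ψ t‖ * |1 - ‖ψ t‖ ^ 2| := by nlinarith
    nlinarith
  have h1 : ∫ t in x..(x + 1), (D + 1) ≤
      ∫ t in x..(x + 1), ‖ψ t * (1 - (‖ψ t‖ ^ 2 : ℝ))‖ ^ 2 :=
    intervalIntegral.integral_mono_on (by linarith) intervalIntegrable_const
      hpot.intervalIntegrable low
  rw [intervalIntegral.integral_of_le (by linarith : x ≤ x + 1) (f := fun t => ‖ψ t * (1 - (‖ψ t‖ ^ 2 : ℝ))‖ ^ 2)] at h1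
  have h2 := setIntegral_le_integral (s := Set.Ioc x (x + 1)) hpot
    (Filter.Eventually.of_forall fun t => by positivity)
  simp only [intervalIntegral.integral_const, add_sub_cancel_left, one_smul] at h1
  linarith
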